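/- For every m≥3, D(t_m) = (m/22)(−6t_m+8t_{m-1}+7t_{m-2}) + (1/44)(−23t_m+34t_{m-1}−5t_{m-2}) + m/6 − (1/4)·[m≡0 (mod 3)] + (1/12)·[m≡1 (mod 3)] + (5/12)·[m≡2 (mod 3)], where [P] equals 1 if P holds and 0 otherwise. -/

import Mathlib

/-- The three-letter alphabet of the Tribonacci word. -/
inductive TLetter : Type
  | a | b | c
deriving DecidableEq

/-- The Tribonacci substitution σ(a)=ab, σ(b)=ac, σ(c)=a. -/
def tsubst : TLetter → List TLetter
  | .a => [.a, .b]
  | .b => [.a, .c]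
  | .c => [.a]

/-- `Tword m = σ^m(a)`, the m-th finite Tribonacci word. -/
def Tword : ℕ → List TLetter
  | 0 => [.a]
  | n + 1 => (Tword n).flatMap tsubst

/-- The prefix 𝕋[1,n] of the Tribonacci word of length n
(each `Tword n` is a prefix of the next and has length ≥ n). -/
def TPrefix (n : ℕ) : List TLetter := (Tword n).take n

/-- A word is a factor of the Tribonacci word 𝕋. -/
def IsFactorT (w : List TLetter) : Prop := ∃ m, w <:+: Tword m

/-- `tribAux i = t_{i-2}`: Tribonacci numbers, shifted so that the index is a natural. -/
def tribAux : ℕ → ℕ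
  | 0 => 0
  | 1 => 1
  | 2 => 1
  | n + 3 => tribAux (n + 2) + tribAux (n + 1) + tribAux n

/-- The Tribonacci numbers `t m` for `m : ℤ`: t₋₂=0, t₋₁=1, t₀=1,
`t m = t (m-1) + t (m-2) + t (m-3)` for m ≥ 1. (Junk value 0 below -2.) -/
def t (m : ℤ) : ℕ := tribAux (m + 2).toNat

/-- Kernel numbers: k₀=0, k₁=k₂=1, `k m = k (m-1) + k (m-2) + k (m-3) - 1` for m ≥ 3. -/
def kAux : ℕ → ℕ
  | 0 => 0
  | 1 => 1
  | 2 => 1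
  | n + 3 => kAux (n + 2) + kAux (n + 1) + kAux n - 1

def kker (m : ℤ) : ℕ := kAux m.toNat

/-- `A n`: the number of distinct nonempty words w with ww a factor of 𝕋[1,n]. -/
noncomputable def A (n : ℕ) : ℕ := Nat.card {w : List TLetter // w ≠ [] ∧ (w ++ w) <:+: TPrefix n}

/-- `B n`: the number of occurrences of squares in 𝕋[1,n], i.e. of pairs (w,i) with
w nonempty, i ≥ 1, ww occurring in 𝕋 at position i and i + 2|w| - 1 ≤ n. -/
noncomputable def B (n : ℕ) : ℕ :=
  Nat.card {p : List TLetter × ℕ // p.1 ≠ [] ∧ 1 ≤ p.2 ∧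
    p.2 + 2 * p.1.length - 1 ≤ n ∧ (p.1 ++ p.1) <+: (TPrefix n).drop (p.2 - 1)}

/-- `C n`: the number of distinct nonempty words w with www a factor of 𝕋[1,n]. -/
noncomputable def C (n : ℕ) : ℕ := Nat.card {w : List TLetter // w ≠ [] ∧ (w ++ w ++ w) <:+: TPrefix n}

/-- `D n`: the number of occurrences of cubes in 𝕋[1,n], i.e. of pairs (w,i) with
w nonempty, i ≥ 1, www occurring in 𝕋 at position i and i + 3|w| - 1 ≤ n. -/
noncomputable def D (n : ℕ) : ℕ :=
  Nat.card {p : List TLetter × ℕ // p.1 ≠ [] ∧ 1 ≤ p.2 ∧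
    p.2 + 3 * p.1.length - 1 ≤ n ∧ (p.1 ++ p.1 ++ p.1) <+: (TPrefix n).drop (p.2 - 1)}

/-! ### The infinite Tribonacci word -/

/-- The letter of the infinite Tribonacci word at the (zero-based) position `i`. -/
def tribWord (i : ℕ) : TLetter := (Tword i).getD i .a

/-- The factor of the Tribonacci word of length `l` starting at position `i`. -/
def tribFactor (i l : ℕ) : List TLetter := (List.range' i l).map tribWord

/-- The position at which the image of the `k`-th letter starts under the substitution. -/
def blockStart (k : ℕ) : ℕ := ((tribFactor 0 k).flatMap tsubst).length

@[simp] lemma length_tribFactor (i l : ℕ) : (tribFactor i l).length = l := by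
  simp [tribFactor]

lemma tribFactor_append (i l l' : ℕ) :
    tribFactor i l ++ tribFactor (i + l) l' = tribFactor i (l + l') := by
  simp [tribFactor, ← List.map_append]

lemma tribFactor_eq_iff {i j l : ℕ} :
    tribFactor i l = tribFactor j l ↔ ∀ y < l, tribWord (i + y) = tribWord (j + y) := by
  constructor
  · intro h y hy
    have := congrArg (fun u => u[y]?) h
    simpa [tribFactor, hy] using this
  · intro h
    apply List.ext_getElem <;> simp [tribFactor]
    exact h

lemma eq_tribFactor_of_prefix {u : List TLetter} {i l : ℕ} (h : u <+: tribFactor i l) :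
    u = tribFactor i u.length := by
  have hl : u.length ≤ l := by simpa using h.length_le
  obtain ⟨d, rfl⟩ := Nat.exists_eq_add_of_le hl
  rw [← tribFactor_append] at h
  exact (List.prefix_of_prefix_length_le h (List.prefix_append _ _) (by simp)).eq_of_length
    (by simp)

lemma one_le_length_tsubst (x : TLetter) : 1 ≤ (tsubst x).length := by
  cases x <;> simp [tsubst]

lemma length_le_length_flatMap_tsubst (u : List TLetter) :
    u.length ≤ (u.flatMap tsubst).length := by
  induction u with
  | nil => simp
  | cons x u ih =>
    have := one_le_length_tsubst x
    simp only [List.flatMap_cons, List.length_append, List.length_cons]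
    omega

lemma flatMap_tsubst_prefix {u v : List TLetter} (h : u <+: v) :
    u.flatMap tsubst <+: v.flatMap tsubst := by
  obtain ⟨z, rfl⟩ := h
  simp

lemma Tword_prefix_succ (n : ℕ) : Tword n <+: Tword (n + 1) := by
  induction n with
  | zero => simp [Tword, tsubst]
  | succ n ih => exact flatMap_tsubst_prefix ih

lemma Tword_prefix_of_le {n n' : ℕ} (h : n ≤ n') : Tword n <+: Tword n' := by
  induction n', h using Nat.le_induction with
  | base => exact List.prefix_rfl
  | succ k _ ih => exact ih.trans (Tword_prefix_succ k)

lemma lt_length_Tword (n : ℕ) : n < (Tword n).length := by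
  induction n with
  | zero => simp [Tword]
  | succ n ih =>
    obtain ⟨z, hz⟩ := Tword_prefix_of_le (Nat.zero_le n)
    have := length_le_length_flatMap_tsubst z
    simp only [Tword, ← hz, List.length_append, List.length_cons, List.length_nil,
      List.flatMap_append, List.flatMap_cons, List.flatMap_nil, tsubst] at ih ⊢
    omega

lemma Tword_eq_tribFactor (n : ℕ) : Tword n = tribFactor 0 (Tword n).length := by
  apply List.ext_getElem
  · simp
  · intro i h _
    have hi := lt_length_Tword i
    simp only [tribFactor, tribWord, List.getElem_map, List.getElem_range', zero_add, one_mul,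
      List.getD_eq_getElem _ _ hi]
    rcases le_total i n with hin | hin
    · exact ((Tword_prefix_of_le hin).getElem hi).symm
    · exact (Tword_prefix_of_le hin).getElem h

lemma flatMap_tribFactor (k : ℕ) :
    (tribFactor 0 k).flatMap tsubst = tribFactor 0 (blockStart k) := by
  have h : tribFactor 0 k <+: Tword k := by
    rw [Tword_eq_tribFactor]
    obtain ⟨d, hd⟩ := Nat.exists_eq_add_of_le (lt_length_Tword k).le
    rw [hd, ← tribFactor_append]
    exact List.prefix_append _ _
  have h' : (tribFactor 0 k).flatMap tsubst <+: Tword (k + 1) := flatMap_tsubst_prefix h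
  rw [Tword_eq_tribFactor] at h'
  exact eq_tribFactor_of_prefix h'

lemma blockStart_succ (k : ℕ) :
    blockStart (k + 1) = blockStart k + (tsubst (tribWord k)).length := by
  rw [blockStart, ← tribFactor_append]
  simp [blockStart, tribFactor]

lemma tsubst_tribWord (k : ℕ) :
    tsubst (tribWord k) = tribFactor (blockStart k) (tsubst (tribWord k)).length := by
  have h := flatMap_tribFactor (k + 1)
  rw [blockStart_succ, ← tribFactor_append, ← tribFactor_append, List.flatMap_append,
    flatMap_tribFactor, zero_add, zero_add, List.append_cancel_left_eq] at h
  simpa [tribFactor] using h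

lemma blockStart_zero : blockStart 0 = 0 := rfl

lemma tribWord_blockStart (k : ℕ) : tribWord (blockStart k) = .a := by
  have h := tsubst_tribWord k
  cases hk : tribWord k <;> simp [hk, tsubst, tribFactor, List.range'] at h <;> grind

lemma tribWord_zero : tribWord 0 = .a := tribWord_blockStart 0

lemma blockStart_succ_of_a {k : ℕ} (h : tribWord k = .a) :
    blockStart (k + 1) = blockStart k + 2 ∧ tribWord (blockStart k + 1) = .b := by
  have h' := tsubst_tribWord k
  simp [h, tsubst, tribFactor, List.range'] at h'
  exact ⟨by simp [blockStart_succ, h, tsubst], h'.2.symm⟩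

lemma blockStart_succ_of_b {k : ℕ} (h : tribWord k = .b) :
    blockStart (k + 1) = blockStart k + 2 ∧ tribWord (blockStart k + 1) = .c := by
  have h' := tsubst_tribWord k
  simp [h, tsubst, tribFactor, List.range'] at h'
  exact ⟨by simp [blockStart_succ, h, tsubst], h'.2.symm⟩

lemma blockStart_succ_of_c {k : ℕ} (h : tribWord k = .c) :
    blockStart (k + 1) = blockStart k + 1 ∧ tribWord (blockStart k + 1) = .a := by
  have h' : blockStart (k + 1) = blockStart k + 1 := by simp [blockStart_succ, h, tsubst]
  exact ⟨h', h' ▸ tribWord_blockStart (k + 1)⟩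

lemma blockStart_strictMono : StrictMono blockStart := by
  refine strictMono_nat_of_lt_succ fun k => ?_
  have := one_le_length_tsubst (tribWord k)
  rw [blockStart_succ]
  omega

lemma eq_of_tribWord_blockStart_succ {k l : ℕ}
    (h : tribWord (blockStart k + 1) = tribWord (blockStart l + 1)) :
    tribWord k = tribWord l := by
  have := @blockStart_succ_of_a
  have := @blockStart_succ_of_b
  have := @blockStart_succ_of_c
  cases hk : tribWord k <;> cases hl : tribWord l <;> grind

lemma exists_blockStart (i : ℕ) :
    ∃ k, blockStart k = i ∨ blockStart k + 1 = i ∧ tribWord k ≠ .c := by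
  induction i with
  | zero => exact ⟨0, Or.inl blockStart_zero⟩
  | succ i ih =>
    obtain ⟨k, rfl | ⟨rfl, hk⟩⟩ := ih
    · by_cases hk : tribWord k = .c
      · exact ⟨k + 1, Or.inl (blockStart_succ_of_c hk).1⟩
      · exact ⟨k, Or.inr ⟨rfl, hk⟩⟩
    · refine ⟨k + 1, Or.inl ?_⟩
      cases h : tribWord k
      · exact (blockStart_succ_of_a h).1
      · exact (blockStart_succ_of_b h).1
      · exact absurd h hk

lemma exists_blockStart_of_eq_a {i : ℕ} (h : tribWord i = .a) : ∃ k, blockStart k = i := by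
  obtain ⟨k, hk | ⟨rfl, hk⟩⟩ := exists_blockStart i
  · exact ⟨k, hk⟩
  · have := @blockStart_succ_of_a k
    have := @blockStart_succ_of_b k
    cases h' : tribWord k <;> grind

lemma exists_blockStart_of_ne_a {i : ℕ} (h : tribWord i ≠ .a) :
    ∃ k, blockStart k + 1 = i ∧ blockStart (k + 1) = i + 1 ∧ tribWord k ≠ .c := by
  obtain ⟨k, rfl | ⟨rfl, hk⟩⟩ := exists_blockStart i
  · exact absurd (tribWord_blockStart k) h
  · have := @blockStart_succ_of_a k
    have := @blockStart_succ_of_b k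
    refine ⟨k, rfl, ?_, hk⟩
    cases h' : tribWord k <;> grind

lemma tribWord_succ_of_ne_a {i : ℕ} (h : tribWord i ≠ .a) : tribWord (i + 1) = .a := by
  obtain ⟨k, -, hk, -⟩ := exists_blockStart_of_ne_a h
  exact hk ▸ tribWord_blockStart (k + 1)

lemma exists_of_eq_b {i : ℕ} (h : tribWord i = .b) :
    ∃ k, i = blockStart k + 1 ∧ tribWord k = .a := by
  obtain ⟨k, rfl, -, hk⟩ := exists_blockStart_of_ne_a (i := i) (by simp [h])
  have := @blockStart_succ_of_b k
  cases h' : tribWord k <;> grind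

lemma exists_of_eq_c {i : ℕ} (h : tribWord i = .c) :
    ∃ k, i = blockStart k + 1 ∧ tribWord k = .b := by
  obtain ⟨k, rfl, -, hk⟩ := exists_blockStart_of_ne_a (i := i) (by simp [h])
  have := @blockStart_succ_of_a k
  cases h' : tribWord k <;> grind

lemma tribWord_after_c {k : ℕ} (h : tribWord k = .c) :
    tribWord (k + 1) = .a ∧ tribWord (k + 2) = .b := by
  obtain ⟨j, rfl, hj⟩ := exists_of_eq_c h
  have h1 := (blockStart_succ_of_b hj).1
  have h2 := tribWord_blockStart (j + 1)
  have h3 := (blockStart_succ_of_a (tribWord_succ_of_ne_a (i := j) (by simp [hj]))).2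
  rw [h1] at h2 h3
  exact ⟨h2, h3⟩

lemma blockStart_add_three_le (k : ℕ) : blockStart k + 3 ≤ blockStart (k + 2) := by
  have h0 := blockStart_strictMono (Nat.lt_succ_self k)
  have h1 := blockStart_strictMono (Nat.lt_succ_self (k + 1))
  simp only [Nat.succ_eq_add_one, add_assoc, Nat.reduceAdd] at h0 h1
  by_cases h : tribWord k = .a
  · have := (blockStart_succ_of_a h).1
    omega
  · have := (blockStart_succ_of_a (tribWord_succ_of_ne_a h)).1
    simp only [add_assoc, Nat.reduceAdd] at this
    omega

lemma blockStart_add_le (k q : ℕ) : blockStart k + q ≤ blockStart (k + q) := by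
  induction q with
  | zero => simp
  | succ q ih =>
    have : blockStart (k + q) < blockStart (k + (q + 1)) := blockStart_strictMono (by omega)
    omega

/-! ### Iterated substitution and Tribonacci numbers -/

/-- The length of the image of a letter under the `j`-th power of the substitution. -/
def imageLength (j : ℕ) : TLetter → ℕ
  | .a => tribAux (j + 2)
  | .b => tribAux (j + 1) + tribAux j
  | .c => tribAux (j + 1)

lemma iterate_blockStart_succ (j k : ℕ) :
    blockStart^[j] (k + 1) = blockStart^[j] k + imageLength j (tribWord k) := by
  induction j generalizing k with
  | zero => cases tribWord k <;> simp [imageLength, tribAux]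
  | succ j ih =>
    have ha := tribWord_blockStart k
    simp only [Function.iterate_succ_apply]
    cases h : tribWord k
    · rw [(blockStart_succ_of_a h).1, ih (blockStart k + 1), ih, ha, (blockStart_succ_of_a h).2]
      simp only [imageLength, tribAux, add_assoc]
    · rw [(blockStart_succ_of_b h).1, ih (blockStart k + 1), ih, ha, (blockStart_succ_of_b h).2]
      simp only [imageLength, add_assoc, Nat.reduceAdd]
    · rw [(blockStart_succ_of_c h).1, ih, ha]
      simp only [imageLength]

lemma iterate_blockStart_zero (j : ℕ) : blockStart^[j] 0 = 0 :=
  Function.iterate_fixed blockStart_zero j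

lemma iterate_blockStart_one (j : ℕ) : blockStart^[j] 1 = tribAux (j + 2) := by
  have h := iterate_blockStart_succ j 0
  rwa [iterate_blockStart_zero, tribWord_zero, zero_add, zero_add] at h

lemma blockStart_tribAux (j : ℕ) : blockStart (tribAux (j + 2)) = tribAux (j + 3) := by
  rw [← iterate_blockStart_one, ← Function.iterate_succ_apply' blockStart, iterate_blockStart_one]

lemma iterate_blockStart_tribAux (i j : ℕ) :
    blockStart^[i] (tribAux (j + 2)) = tribAux (i + j + 2) := by
  rw [← iterate_blockStart_one, ← Function.iterate_add_apply, iterate_blockStart_one]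

lemma TPrefix_eq_tribFactor (n : ℕ) : TPrefix n = tribFactor 0 n := by
  have h : TPrefix n <+: tribFactor 0 (Tword n).length := by
    rw [← Tword_eq_tribFactor]
    exact List.take_prefix _ _
  have h' := eq_tribFactor_of_prefix h
  rwa [TPrefix, List.length_take, min_eq_left (lt_length_Tword n).le] at h'

lemma tribAux_mono : Monotone tribAux := by
  refine monotone_nat_of_le_succ fun n => ?_
  match n with
  | 0 => simp [tribAux]
  | 1 => simp [tribAux]
  | n + 2 => simp only [tribAux]; omega

lemma tribAux_pos (n : ℕ) : 0 < tribAux (n + 1) :=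
  Nat.lt_of_lt_of_le (by simp [tribAux]) (tribAux_mono (Nat.le_add_left 1 n))

lemma tribAux_strictMono : StrictMono fun n => tribAux (n + 2) := by
  refine strictMono_nat_of_lt_succ fun n => ?_
  have := tribAux_pos n
  simp only [tribAux]
  omega

/-! ### Repetitions with long periods -/

/-- The number of positions in a maximal run, whose period is the `n`-th Tribonacci number, at
which the letter agrees with the one a period later. -/
def runLength : ℕ → ℕ
  | 0 => 1
  | n + 1 => blockStart (runLength n) + 1

lemma blockStart_add_of_agree {y u : ℕ} (h : ∀ j < u, tribWord (y + j) = tribWord j) :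
    blockStart (y + u) = blockStart y + blockStart u := by
  induction u with
  | zero => simp [blockStart_zero]
  | succ u ih =>
    rw [← add_assoc, blockStart_succ, ih fun j hj => h j (by omega), h u (by omega),
      blockStart_succ]
    omega

lemma agree_blockStart {y u : ℕ} (h : ∀ j < u, tribWord (y + j) = tribWord j) :
    ∀ j < blockStart u + 1, tribWord (blockStart y + j) = tribWord j := by
  intro j hj
  obtain ⟨k, rfl | ⟨rfl, hk⟩⟩ := exists_blockStart j
  · have hku : k ≤ u := blockStart_strictMono.le_iff_le.1 (by omega)
    rw [← blockStart_add_of_agree fun j hj => h j (by omega), tribWord_blockStart,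
      tribWord_blockStart]
  · have hku : k < u := blockStart_strictMono.lt_iff_lt.1 (by omega)
    rw [← add_assoc, ← blockStart_add_of_agree fun j hj => h j (by omega)]
    have hyk := h k hku
    have := @blockStart_succ_of_a
    have := @blockStart_succ_of_b
    cases h' : tribWord k <;> grind

lemma agree_iterate_blockStart (n k : ℕ) :
    ∀ j < runLength n, tribWord (blockStart^[n + 1] k + j) = tribWord j := by
  induction n with
  | zero => simp [runLength, tribWord_blockStart, tribWord_zero]
  | succ n ih =>
    rw [Function.iterate_succ_apply']
    exact agree_blockStart ih

lemma runLength_succ (n : ℕ) : runLength (n + 1) = tribAux (n + 3) + runLength n := by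
  induction n with
  | zero =>
    have := (blockStart_succ_of_a tribWord_zero).1
    simp only [runLength, tribAux]
    grind [blockStart_zero]
  | succ n ih =>
    have h := agree_iterate_blockStart n 1
    rw [iterate_blockStart_one] at h
    calc runLength (n + 1 + 1) = blockStart (runLength (n + 1)) + 1 := rfl
      _ = tribAux (n + 1 + 3) + (blockStart (runLength n) + 1) := by
        rw [ih, blockStart_add_of_agree h, blockStart_tribAux (n + 1), add_assoc]
      _ = tribAux (n + 1 + 3) + runLength (n + 1) := rfl

lemma runLength_add_three (n : ℕ) :
    runLength (n + 3) = runLength (n + 2) + runLength (n + 1) + runLength n + 3 := by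
  induction n with
  | zero =>
    have h0 : runLength 0 = 1 := rfl
    simp [runLength_succ, tribAux, h0]
  | succ n ih =>
    have e1 := runLength_succ n
    have e2 := runLength_succ (n + 1)
    have e3 := runLength_succ (n + 2)
    have e4 := runLength_succ (n + 3)
    simp only [tribAux, add_assoc, Nat.reduceAdd] at *
    omega

/-- `RepeatsOn p s e` says that the factor on the positions `s, …, e + p - 1` has period `p`. -/
def RepeatsOn (p s e : ℕ) : Prop := ∀ y, s ≤ y → y < e → tribWord y = tribWord (y + p)

lemma RepeatsOn.blockStart_add {q s e : ℕ} (h : RepeatsOn q s e) {y : ℕ} (hs : s ≤ y)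
    (he : y ≤ e) : blockStart (y + q) + blockStart s = blockStart y + blockStart (s + q) := by
  induction y, hs using Nat.le_induction with
  | base => omega
  | succ y hy ih =>
    have h1 := h y hy (by omega)
    have h2 := blockStart_succ y
    have h3 := blockStart_succ (y + q)
    rw [← h1] at h3
    rw [show y + 1 + q = y + q + 1 by omega]
    have := ih (by omega)
    omega

lemma iterate_blockStart_succ_of_c {n k : ℕ} (hk : tribWord k = .c) :
    blockStart^[n + 1] (k + 1) = blockStart^[n + 1] k + tribAux (n + 2) := by
  simp [iterate_blockStart_succ, hk, imageLength]

lemma repeatsOn_run {n k : ℕ} (hk : tribWord k = .c) :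
    RepeatsOn (tribAux (n + 2)) (blockStart^[n + 1] k) (blockStart^[n + 1] k + runLength n) := by
  intro y hs he
  obtain ⟨d, rfl⟩ := Nat.exists_eq_add_of_le hs
  have h1 := agree_iterate_blockStart n k d (by omega)
  have h2 := agree_iterate_blockStart n (k + 1) d (by omega)
  rw [iterate_blockStart_succ_of_c hk] at h2
  rw [h1, ← h2]
  congr 1
  omega

lemma RepeatsOn.of_blockStart {p q k l : ℕ} (h : RepeatsOn p (blockStart k) (blockStart l + 1))
    (hq : blockStart (k + q) = blockStart k + p) :
    ∀ y, k ≤ y → y ≤ l → blockStart (y + q) = blockStart y + p ∧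
      (y < l → tribWord y = tribWord (y + q)) := by
  have key : ∀ y, k ≤ y → y < l → blockStart (y + q) = blockStart y + p →
      tribWord y = tribWord (y + q) := by
    intro y hy hl hyq
    apply eq_of_tribWord_blockStart_succ
    have h1 := blockStart_strictMono.monotone hy
    have h2 := blockStart_strictMono hl
    rw [h _ (by omega) (by omega), hyq]
    congr 1
    omega
  intro y hy
  induction y, hy using Nat.le_induction with
  | base => exact fun hl => ⟨hq, fun hl' => key k le_rfl hl' hq⟩
  | succ y hy ih =>
    intro hl
    obtain ⟨h1, h2⟩ := ih (by omega)
    have h3 : blockStart (y + 1 + q) = blockStart (y + 1) + p := by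
      rw [show y + 1 + q = y + q + 1 by omega, blockStart_succ, blockStart_succ, h1,
        ← h2 (by omega)]
      omega
    exact ⟨h3, fun hl' => key _ (by omega) hl' h3⟩

/-- A repetition that is almost a cube is contained in the image of a shorter one. -/
lemma RepeatsOn.desubstitute {p s e : ℕ} (h : RepeatsOn p s e) (hp : 2 ≤ p)
    (hlen : 2 * p + s ≤ e + 1) :
    ∃ q k l, 1 ≤ q ∧ q < p ∧ RepeatsOn q k l ∧ 2 * q + k ≤ l + 1 ∧
      blockStart k ≤ s ∧ e ≤ blockStart l + 1 ∧ blockStart (k + q) = blockStart k + p := by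
  obtain ⟨k, k', hks, hks', hk'⟩ : ∃ k k', blockStart k ≤ s ∧ s ≤ blockStart k + 1 ∧
      blockStart k' = blockStart k + p := by
    have hs := h s le_rfl (by omega)
    by_cases hsa : tribWord s = .a
    · obtain ⟨k, rfl⟩ := exists_blockStart_of_eq_a hsa
      obtain ⟨k', hk'⟩ := exists_blockStart_of_eq_a (hs ▸ hsa)
      exact ⟨k, k', le_rfl, by omega, hk'⟩
    · obtain ⟨k, hk, -⟩ := exists_blockStart_of_ne_a hsa
      obtain ⟨k', hk', -⟩ := exists_blockStart_of_ne_a (hs ▸ hsa)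
      exact ⟨k, k', by omega, by omega, by omega⟩
  obtain ⟨q, rfl⟩ : ∃ q, k' = k + q :=
    Nat.exists_eq_add_of_le (blockStart_strictMono.le_iff_le.1 (by omega))
  have hka : tribWord (blockStart k) = tribWord (blockStart k + p) := by
    rw [← hk', tribWord_blockStart, tribWord_blockStart]
  obtain ⟨l, hel, hrep⟩ : ∃ l, e ≤ blockStart l + 1 ∧
      RepeatsOn p (blockStart k) (blockStart l + 1) := by
    obtain ⟨e', rfl⟩ : ∃ e', e = e' + 1 := ⟨e - 1, by omega⟩
    have he := h e' (by omega) (by omega)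
    by_cases hea : tribWord e' = .a
    · obtain ⟨l, rfl⟩ := exists_blockStart_of_eq_a hea
      refine ⟨l, le_rfl, fun y hy hy' => ?_⟩
      rcases hy.eq_or_lt with rfl | hlt
      · exact hka
      · exact h y (by omega) hy'
    · obtain ⟨l, -, hl, -⟩ := exists_blockStart_of_ne_a hea
      have hend := tribWord_succ_of_ne_a (he ▸ hea)
      refine ⟨l + 1, by omega, fun y hy hy' => ?_⟩
      rcases hy.eq_or_lt with rfl | hlt
      · exact hka
      · rcases (show y ≤ e' + 1 by omega).eq_or_lt with rfl | hlt'
        · rw [show e' + 1 + p = e' + p + 1 by omega, hend, tribWord_succ_of_ne_a hea]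
        · exact h y (by omega) hlt'
  have hblock := hrep.of_blockStart hk'
  have hkql : k + q ≤ l := blockStart_strictMono.le_iff_le.1 (by omega)
  have h2q := (hblock (k + q) (by omega) hkql).1
  refine ⟨q, k, l, ?_, ?_, fun y hy hy' => (hblock y hy hy'.le).2 hy', ?_, hks, hel, hk'⟩
  · rcases Nat.eq_zero_or_pos q with rfl | hq
    · simp at hk'
      omega
    · exact hq
  · rcases Nat.lt_or_ge q 2 with hq | hq
    · omega
    · obtain ⟨r, rfl⟩ := Nat.exists_eq_add_of_le hq
      have h1 := blockStart_add_three_le k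
      have h2 := blockStart_add_le (k + 2) r
      rw [← add_assoc] at hk'
      omega
  · by_contra hcon
    have h1 := blockStart_add_three_le l
    have h2 : blockStart (l + 2) ≤ blockStart (k + q + q) :=
      blockStart_strictMono.monotone (by omega)
    omega

/-- Every repetition that is almost a cube is contained in one of the standard runs. -/
lemma RepeatsOn.exists_run {p s e : ℕ} (h : RepeatsOn p s e) (hp : 1 ≤ p)
    (hlen : 2 * p + s ≤ e + 1) :
    ∃ n k, tribWord k = .c ∧ p = tribAux (n + 2) ∧ blockStart^[n + 1] k ≤ s ∧
      e ≤ blockStart^[n + 1] k + runLength n := by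
  induction p using Nat.strong_induction_on generalizing s e with
  | _ p ih =>
  rcases hp.eq_or_lt with rfl | hp
  · have hs := h s le_rfl (by omega)
    have hsa : tribWord s = .a := by
      by_contra hne
      exact hne (hs.trans (tribWord_succ_of_ne_a hne))
    obtain ⟨k, rfl⟩ := exists_blockStart_of_eq_a hsa
    have hk : tribWord k = .c := by
      have := @blockStart_succ_of_a k
      have := @blockStart_succ_of_b k
      cases hk : tribWord k <;> grind
    refine ⟨0, k, hk, rfl, le_rfl, ?_⟩
    simp only [Function.iterate_one, zero_add, runLength]
    by_contra hcon
    have h1 := h (blockStart k + 1) (by omega) (by omega)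
    have h2 := blockStart_succ_of_a (tribWord_after_c hk).1
    rw [(blockStart_succ_of_c hk).1] at h2
    rw [(blockStart_succ_of_c hk).2, h2.2] at h1
    simp at h1
  · obtain ⟨q, k, l, hq, hqp, hrep, hkl, hks, hel, hpq⟩ := h.desubstitute hp hlen
    obtain ⟨n, k₀, hc, rfl, hk, hl⟩ := ih q hqp hrep hq hkl
    have hrun := repeatsOn_run (n := n) hc
    refine ⟨n + 1, k₀, hc, ?_, ?_, ?_⟩
    · have h1 := hrun.blockStart_add hk (by omega)
      rw [← iterate_blockStart_succ_of_c hc, ← Function.iterate_succ_apply' blockStart,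
        ← Function.iterate_succ_apply' blockStart, iterate_blockStart_succ_of_c hc] at h1
      simp only [Nat.succ_eq_add_one] at h1
      omega
    · rw [Function.iterate_succ_apply']
      exact (blockStart_strictMono.monotone hk).trans hks
    · have h1 := blockStart_strictMono.monotone hl
      rw [blockStart_add_of_agree (agree_iterate_blockStart n k₀)] at h1
      rw [Function.iterate_succ_apply', runLength]
      omega

/-! ### Counting cubes -/

/-- The number of cubes in a run whose period is the `n`-th Tribonacci number. -/
def cubesPerRun : ℕ → ℕ
  | 0 => 0
  | 1 => 0
  | 2 => 0
  | n + 3 => cubesPerRun (n + 2) + cubesPerRun (n + 1) + cubesPerRun n + 1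

lemma cubesPerRun_add (n : ℕ) : cubesPerRun n + 2 * tribAux (n + 2) = runLength n + 1 := by
  induction n using cubesPerRun.induct with
  | case1 => rfl
  | case2 =>
    have h0 : runLength 0 = 1 := rfl
    simp [runLength_succ, cubesPerRun, tribAux, h0]
  | case3 =>
    have h0 : runLength 0 = 1 := rfl
    simp [runLength_succ, cubesPerRun, tribAux, h0]
  | case4 n h2 h1 h0 =>
    have e := runLength_add_three n
    simp only [Nat.succ_eq_add_one, cubesPerRun, tribAux, add_assoc, Nat.reduceAdd] at *
    omega

lemma runLength_le (n : ℕ) : runLength n ≤ tribAux (n + 4) := by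
  induction n with
  | zero => simp [runLength, tribAux]
  | succ n ih =>
    rw [runLength_succ]
    simp only [tribAux] at *
    omega

lemma three_le_of_cubesPerRun_pos {n : ℕ} (h : 0 < cubesPerRun n) : 3 ≤ n := by
  match n with
  | 0 | 1 | 2 => simp [cubesPerRun] at h
  | n + 3 => omega

/-- The positions of the letter `c` in the prefix of length `n` other than the last two positions
of that prefix. -/
def cPositions (n : ℕ) : Finset ℕ := {k ∈ Finset.range (n - 2) | tribWord k = .c}

lemma iterate_blockStart_strictMono (j : ℕ) : StrictMono blockStart^[j] :=
  blockStart_strictMono.iterate j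

lemma cube_fits_iff {m n k d : ℕ} (hk : tribWord k = .c) (hd : d < cubesPerRun n) :
    blockStart^[n + 1] k + d + 3 * tribAux (n + 2) ≤ tribAux (m + 2) ↔
      n < m ∧ k ∈ cPositions (tribAux (m - 1 - n + 2)) := by
  have hg := cubesPerRun_add n
  have hr := runLength_le n
  obtain ⟨hk1, hk2⟩ := tribWord_after_c hk
  have e1 := iterate_blockStart_succ_of_c (n := n) hk
  have e2 := iterate_blockStart_succ (n + 1) (k + 1)
  have e3 := iterate_blockStart_succ (n + 1) (k + 2)
  rw [hk1] at e2
  rw [hk2] at e3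
  simp only [imageLength, tribAux] at e2 e3 hr
  obtain ⟨n', rfl⟩ : ∃ n', n = n' + 3 :=
    ⟨n - 3, by have := three_le_of_cubesPerRun_pos (n := n) (by omega); omega⟩
  have hpos := tribAux_pos (n' + 1)
  rcases Nat.lt_or_ge (n' + 3) m with hnm | hnm
  · obtain ⟨j, rfl⟩ := Nat.exists_eq_add_of_lt hnm
    have e4 := iterate_blockStart_tribAux (n' + 3 + 1) j
    rw [show n' + 3 + 1 + j + 2 = n' + 3 + j + 1 + 2 by omega] at e4
    rw [show n' + 3 + j + 1 - 1 - (n' + 3) + 2 = j + 2 by omega, ← e4, cPositions,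
      Finset.mem_filter, Finset.mem_range]
    simp only [hk, hnm, true_and, and_true]
    constructor
    · intro h
      by_contra hcon
      have h5 := (iterate_blockStart_strictMono (n' + 3 + 1)).monotone
        (show tribAux (j + 2) ≤ k + 1 + 1 by omega)
      simp only [tribAux, add_assoc, Nat.reduceAdd] at *
      omega
    · intro h
      have h5 := (iterate_blockStart_strictMono (n' + 3 + 1)).monotone
        (show k + 2 + 1 ≤ tribAux (j + 2) by omega)
      simp only [tribAux, add_assoc, Nat.reduceAdd] at *
      omega
  · have h5 := tribAux_mono (show m + 2 ≤ n' + 3 + 2 by omega)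
    have h6 := tribAux_pos (n' + 3 + 1)
    simp only [add_assoc, Nat.reduceAdd] at *
    constructor
    · intro h
      omega
    · intro h
      omega

lemma run_unique {n k k' d d' : ℕ} (hk : tribWord k = .c) (hk' : tribWord k' = .c)
    (hd : d < cubesPerRun n) (hd' : d' < cubesPerRun n)
    (h : blockStart^[n + 1] k + d = blockStart^[n + 1] k' + d') : k = k' := by
  wlog hlt : k < k' generalizing k k' d d'
  · rcases (not_lt.1 hlt).eq_or_lt with h' | h'
    · exact h'.symm
    · exact (this hk' hk hd' hd h.symm h').symm
  exfalso
  have hg := cubesPerRun_add n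
  have hr := runLength_le n
  obtain ⟨hk1, hk2⟩ := tribWord_after_c hk
  have hlt2 : k + 1 + 1 ≤ k' := by
    rcases (show k + 1 ≤ k' by omega).eq_or_lt with rfl | h'
    · simp [hk1] at hk'
    · exact h'
  have e1 := iterate_blockStart_succ_of_c (n := n) hk
  have e2 := iterate_blockStart_succ (n + 1) (k + 1)
  have e3 := (iterate_blockStart_strictMono (n + 1)).monotone hlt2
  rw [hk1] at e2
  have := tribAux_mono (show n + 1 ≤ n + 2 by omega)
  have := tribAux_pos (n + 1)
  simp only [imageLength, tribAux, add_assoc, Nat.reduceAdd] at *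
  omega

lemma cube_iff {w : List TLetter} {n i : ℕ} (hw : w ≠ []) :
    (w ++ w ++ w) <+: (TPrefix n).drop i ↔
      w = tribFactor i w.length ∧ RepeatsOn w.length i (i + 2 * w.length) ∧
        i + 3 * w.length ≤ n := by
  have hpos := List.length_pos_iff.2 hw
  have hsplit (l : ℕ) : tribFactor i (l + l + l) =
      tribFactor i l ++ tribFactor (i + l) l ++ tribFactor (i + l + l) l := by
    rw [tribFactor_append, add_assoc i l l, tribFactor_append]
  rw [TPrefix_eq_tribFactor]
  rcases Nat.lt_or_ge n i with hni | hni
  · rw [List.drop_eq_nil_of_le (by simp; omega)]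
    simp [hw]
    omega
  · obtain ⟨d, rfl⟩ := Nat.exists_eq_add_of_le hni
    rw [← tribFactor_append, List.drop_left' (by simp), zero_add]
    constructor
    · intro h
      have hlen := h.length_le
      have h' := eq_tribFactor_of_prefix h
      simp only [List.length_append, length_tribFactor] at h' hlen
      rw [hsplit] at h'
      obtain ⟨h12, h3⟩ := List.append_inj h' (by simp)
      obtain ⟨h1, h2⟩ := List.append_inj h12 (by simp)
      refine ⟨h1, ?_, by omega⟩
      have e1 := tribFactor_eq_iff.1 (h1.symm.trans h2)
      have e2 := tribFactor_eq_iff.1 (h2.symm.trans h3)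
      intro y hy hy'
      obtain ⟨z, rfl⟩ := Nat.exists_eq_add_of_le hy
      rcases Nat.lt_or_ge z w.length with hz | hz
      · rw [e1 z hz]
        congr 1
        omega
      · obtain ⟨v, rfl⟩ := Nat.exists_eq_add_of_le hz
        rw [← add_assoc, e2 v (by omega)]
        congr 1
        omega
    · rintro ⟨h1, hrep, hle⟩
      generalize w.length = l at *
      subst h1
      have e1 : tribFactor i l = tribFactor (i + l) l := by
        rw [tribFactor_eq_iff]
        intro y hy
        rw [hrep _ (by omega) (by omega)]
        congr 1
        omega
      have e2 : tribFactor (i + l) l = tribFactor (i + l + l) l := by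
        rw [tribFactor_eq_iff]
        intro y hy
        rw [hrep _ (by omega) (by omega)]
        congr 1
        omega
      have h3 := hsplit l
      rw [← e2, ← e1] at h3
      obtain ⟨z, rfl⟩ := Nat.exists_eq_add_of_le (show l + l + l ≤ d by omega)
      rw [← h3, ← tribFactor_append i (l + l + l) z]
      exact List.prefix_append _ _

lemma D_tribAux (m : ℕ) : D (tribAux (m + 2)) =
    ∑ n ∈ Finset.range m, cubesPerRun n * (cPositions (tribAux (m - 1 - n + 2))).card := by
  classical
  let F : Finset (Σ _ : ℕ, ℕ × ℕ) := (Finset.range m).sigma fun n =>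
    cPositions (tribAux (m - 1 - n + 2)) ×ˢ Finset.range (cubesPerRun n)
  have hF : F.card =
      ∑ n ∈ Finset.range m, cubesPerRun n * (cPositions (tribAux (m - 1 - n + 2))).card := by
    simp [F, Finset.card_sigma, mul_comm]
  have mem_F (x : Σ _ : ℕ, ℕ × ℕ) : x ∈ F ↔ tribWord x.2.1 = .c ∧ x.2.2 < cubesPerRun x.1 ∧
      blockStart^[x.1 + 1] x.2.1 + x.2.2 + 3 * tribAux (x.1 + 2) ≤ tribAux (m + 2) := by
    simp only [F, Finset.mem_sigma, Finset.mem_product, Finset.mem_range]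
    constructor
    · rintro ⟨h1, h2, h3⟩
      have hc := (Finset.mem_filter.1 h2).2
      exact ⟨hc, h3, (cube_fits_iff hc h3).2 ⟨h1, h2⟩⟩
    · rintro ⟨hc, h3, h⟩
      obtain ⟨h1, h2⟩ := (cube_fits_iff hc h3).1 h
      exact ⟨h1, h2, h3⟩
  rw [← hF, D, ← Nat.card_eq_finsetCard]
  symm
  refine Nat.card_congr (Equiv.ofBijective (fun x : F =>
    ⟨(tribFactor (blockStart^[x.1.1 + 1] x.1.2.1 + x.1.2.2) (tribAux (x.1.1 + 2)),
      blockStart^[x.1.1 + 1] x.1.2.1 + x.1.2.2 + 1), ?_⟩) ⟨?_, ?_⟩)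
  · obtain ⟨hc, hd, hle⟩ := (mem_F x.1).1 x.2
    have hpos := tribAux_pos (x.1.1 + 1)
    have hne (i : ℕ) : tribFactor i (tribAux (x.1.1 + 2)) ≠ [] := by
      rw [← List.length_pos_iff, length_tribFactor]
      exact hpos
    have hg := cubesPerRun_add x.1.1
    refine ⟨hne _, by simp, by simp only [length_tribFactor]; omega, ?_⟩
    rw [Nat.add_sub_cancel, cube_iff (hne _)]
    simp only [length_tribFactor, true_and]
    refine ⟨fun y hy hy' => repeatsOn_run hc y (by omega) (by omega), hle⟩
  · rintro ⟨⟨n, k, d⟩, hx⟩ ⟨⟨n', k', d'⟩, hx'⟩ h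
    obtain ⟨hc, hd, -⟩ := (mem_F _).1 hx
    obtain ⟨hc', hd', -⟩ := (mem_F _).1 hx'
    simp only [Subtype.mk.injEq, Prod.mk.injEq] at h hc hc' hd hd'
    obtain ⟨h1, h2⟩ := h
    have hn : n = n' := tribAux_strictMono.injective (by simpa using congrArg List.length h1)
    subst hn
    have hk : k = k' := run_unique hc hc' hd hd' (by omega)
    subst hk
    have hd : d = d' := by omega
    subst hd
    rfl
  · rintro ⟨⟨w, i⟩, hw, hi, hle, hcube⟩
    simp only at hw hi hle hcube
    have hpos := List.length_pos_iff.2 hw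
    rw [cube_iff hw] at hcube
    obtain ⟨h1, hrep, -⟩ := hcube
    obtain ⟨n, k, hc, hp, hs, he⟩ := hrep.exists_run hpos (by omega)
    have hg := cubesPerRun_add n
    obtain ⟨d, hd⟩ := Nat.exists_eq_add_of_le hs
    refine ⟨⟨⟨n, k, d⟩, (mem_F _).2 ⟨hc, ?_, ?_⟩⟩, ?_⟩
    · simp only
      omega
    · simp only
      omega
    · simp only [Subtype.mk.injEq, Prod.mk.injEq]
      rw [← hp, ← hd]
      exact ⟨h1.symm, by omega⟩

/-! ### Evaluating the sum -/

lemma tribWord_tribAux_sub_one (n : ℕ) : tribWord (tribAux (n + 2) - 1) =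
    if n % 3 = 0 then .a else if n % 3 = 1 then .b else .c := by
  induction n with
  | zero => exact tribWord_zero
  | succ n ih =>
    obtain ⟨x, hx⟩ : ∃ x, tribAux (n + 2) = x + 1 :=
      ⟨tribAux (n + 2) - 1, (Nat.succ_pred_eq_of_pos (tribAux_pos (n + 1))).symm⟩
    rw [← blockStart_tribAux n, hx]
    rw [hx, Nat.add_sub_cancel] at ih
    rcases (show n % 3 = 0 ∨ n % 3 = 1 ∨ n % 3 = 2 by omega) with h | h | h
    · simp only [h, if_true] at ih
      have := blockStart_succ_of_a ih
      simp [this.1, this.2, show (n + 1) % 3 = 1 by omega]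
    · simp only [h] at ih
      have := blockStart_succ_of_b (by simpa using ih)
      simp [this.1, this.2, show (n + 1) % 3 = 2 by omega]
    · simp only [h] at ih
      have := blockStart_succ_of_c (by simpa using ih)
      simp [this.1, tribWord_blockStart, show (n + 1) % 3 = 0 by omega]

lemma image_position_c (x : ℕ) :
    blockStart (blockStart (blockStart x) + 1) + 1 = blockStart^[3] x + 3 := by
  have h := (blockStart_succ_of_a (tribWord_blockStart (blockStart x))).1
  simp only [Function.iterate_succ_apply', Function.iterate_zero_apply]
  omega

lemma tribWord_eq_c_iff {i : ℕ} : tribWord i = .c ↔ ∃ x, blockStart^[3] x + 3 = i := by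
  simp_rw [← image_position_c]
  constructor
  · intro h
    obtain ⟨k, rfl, hk⟩ := exists_of_eq_c h
    obtain ⟨l, rfl, hl⟩ := exists_of_eq_b hk
    obtain ⟨x, rfl⟩ := exists_blockStart_of_eq_a hl
    exact ⟨x, rfl⟩
  · rintro ⟨x, rfl⟩
    exact (blockStart_succ_of_b (blockStart_succ_of_a (tribWord_blockStart x)).2).2

lemma card_cPositions (j : ℕ) : (cPositions (tribAux (j + 3 + 2))).card +
    (if j % 3 = 2 then 1 else 0) = tribAux (j + 2) := by
  have himage : cPositions (tribAux (j + 3 + 2)) =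
      {x ∈ Finset.range (tribAux (j + 2)) | ¬ (x = tribAux (j + 2) - 1 ∧ j % 3 = 2)}.image
        fun x => blockStart^[3] x + 3 := by
    ext i
    simp only [cPositions, Finset.mem_filter, Finset.mem_range, tribWord_eq_c_iff,
      Finset.mem_image]
    rw [and_comm, ← exists_and_right]
    refine exists_congr fun x => ?_
    rw [and_comm (b := _ + 3 = i)]
    refine and_congr_right ?_
    rintro rfl
    have hlast := tribWord_tribAux_sub_one j
    have hj := iterate_blockStart_tribAux 3 j
    rw [show 3 + j + 2 = j + 3 + 2 by omega] at hj
    have hmono := iterate_blockStart_strictMono 3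
    have e1 := iterate_blockStart_succ 3 x
    rw [← hj]
    constructor
    · intro h
      have hx : x < tribAux (j + 2) := hmono.lt_iff_lt.1 (by omega)
      refine ⟨hx, ?_⟩
      rintro ⟨h1, h2⟩
      rw [← h1] at hlast
      simp only [hlast, h2, imageLength, tribAux, OfNat.ofNat_ne_zero, OfNat.ofNat_ne_one,
        if_false] at e1
      rw [show tribAux (j + 2) = x + 1 by omega] at h
      omega
    · rintro ⟨hx, h⟩
      rcases (show x + 1 ≤ tribAux (j + 2) from hx).eq_or_lt with hx' | hx'
      · rw [← hx', Nat.add_sub_cancel] at hlast h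
        rw [← hx']
        have h2 : ¬ j % 3 = 2 := fun h2 => h ⟨rfl, h2⟩
        rcases (show j % 3 = 0 ∨ j % 3 = 1 by omega) with h3 | h3 <;>
          simp [-Function.iterate_succ, hlast, h3, imageLength, tribAux] at e1 <;> omega
      · have e2 := hmono.monotone (show x + 1 + 1 ≤ tribAux (j + 2) from hx')
        have e3 := iterate_blockStart_succ 3 (x + 1)
        have e4 (y : TLetter) : 4 ≤ imageLength 3 y := by cases y <;> simp [imageLength, tribAux]
        have := e4 (tribWord x)
        have := e4 (tribWord (x + 1))
        omega
  have hinj : Function.Injective fun x => blockStart^[3] x + 3 := fun x y h =>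
    (iterate_blockStart_strictMono 3).injective (by simpa using h)
  have hpos : 0 < tribAux (j + 2) := tribAux_pos (j + 1)
  rw [himage, Finset.card_image_of_injective _ hinj]
  split_ifs with h
  · have : {x ∈ Finset.range (tribAux (j + 2)) | ¬ (x = tribAux (j + 2) - 1 ∧ j % 3 = 2)} =
        Finset.range (tribAux (j + 2) - 1) := by
      ext x
      simp only [Finset.mem_filter, Finset.mem_range, h, and_true]
      omega
    rw [this, Finset.card_range]
    exact Nat.sub_add_cancel hpos
  · simp [h]

/-- The number of runs of the `n`-th kind contributing cubes to the prefix whose length is the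
`(n + j + 1)`-st Tribonacci number. -/
def runCount (j : ℕ) : ℕ := (cPositions (tribAux (j + 2))).card

lemma runCount_of_lt_three {j : ℕ} (h : j < 3) : runCount j = 0 := by
  have hb := (blockStart_succ_of_a tribWord_zero).2
  rw [blockStart_zero] at hb
  have ha := tribWord_zero
  rw [runCount, Finset.card_eq_zero, cPositions, Finset.filter_eq_empty_iff]
  intro k hk
  have h4 : tribAux (j + 2) ≤ 4 := tribAux_mono (show j + 2 ≤ 4 by omega)
  have hk2 : k < 2 := by
    rw [Finset.mem_range] at hk
    omega
  interval_cases k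
  · simp [ha]
  · simp at hb
    simp [hb]

/-- The number of cubes in the prefix whose length is the `m`-th Tribonacci number. -/
def cubeCount (m : ℕ) : ℕ := ∑ n ∈ Finset.range m, cubesPerRun n * runCount (m - 1 - n)

lemma cubeCount_add_four (m : ℕ) : cubeCount (m + 4) = cubeCount (m + 3) + cubeCount (m + 2) +
    cubeCount (m + 1) + ∑ j ∈ Finset.range (m + 1), runCount j := by
  have e3 : cubeCount (m + 3) =
      ∑ n ∈ Finset.range (m + 1), cubesPerRun (n + 2) * runCount (m - n) := by
    rw [cubeCount, Finset.sum_range_succ', Finset.sum_range_succ']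
    simp only [cubesPerRun, zero_mul, add_zero]
    exact Finset.sum_congr rfl fun n _ => by congr 2; omega
  have e2 : cubeCount (m + 2) =
      ∑ n ∈ Finset.range (m + 1), cubesPerRun (n + 1) * runCount (m - n) := by
    rw [cubeCount, Finset.sum_range_succ']
    simp only [cubesPerRun, zero_mul, add_zero]
    exact Finset.sum_congr rfl fun n _ => by congr 2; omega
  have e1 : cubeCount (m + 1) =
      ∑ n ∈ Finset.range (m + 1), cubesPerRun n * runCount (m - n) := rfl
  have e0 : ∑ j ∈ Finset.range (m + 1), runCount j =
      ∑ n ∈ Finset.range (m + 1), runCount (m - n) := by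
    rw [← Finset.sum_range_reflect]
    exact Finset.sum_congr rfl fun n _ => by congr 1
  rw [e3, e2, e1, e0, ← Finset.sum_add_distrib, ← Finset.sum_add_distrib,
    ← Finset.sum_add_distrib, cubeCount, Finset.sum_range_succ', Finset.sum_range_succ',
    Finset.sum_range_succ']
  simp only [cubesPerRun, zero_mul, add_zero]
  refine Finset.sum_congr rfl fun n _ => ?_
  rw [show m + 4 - 1 - (n + 1 + 1 + 1) = m - n by omega]
  ring

lemma sum_runCount (m : ℕ) : 6 * ∑ j ∈ Finset.range (m + 1), runCount j + 5 + 2 * m +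
    3 * tribAux m = 3 * tribAux (m + 2) + 2 * ((m + 1) % 3) := by
  induction m with
  | zero => simp [runCount_of_lt_three, tribAux]
  | succ m ih =>
    rw [Finset.sum_range_succ]
    rcases Nat.lt_or_ge m 2 with hm | hm
    · rw [runCount_of_lt_three (by omega)]
      interval_cases m <;> simp [tribAux] at ih ⊢ <;> omega
    · obtain ⟨i, rfl⟩ := Nat.exists_eq_add_of_le' hm
      have h := card_cPositions i
      change runCount (i + 3) + _ = _ at h
      simp only [tribAux, add_assoc, Nat.reduceAdd] at *
      split_ifs at h <;> omega

lemma cubeCount_eq (m : ℕ) : (cubeCount m : ℚ) =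
    (m : ℚ) / 22 * (-6 * (tribAux (m + 2) : ℚ) + 8 * (tribAux (m + 1) : ℚ) +
      7 * (tribAux m : ℚ)) +
    1 / 44 * (-23 * (tribAux (m + 2) : ℚ) + 34 * (tribAux (m + 1) : ℚ) -
      5 * (tribAux m : ℚ)) +
    (m : ℚ) / 6 - 1 / 4 + ((m % 3 : ℕ) : ℚ) / 3 := by
  induction m using Nat.strong_induction_on with
  | _ m ih =>
  match m with
  | 0 | 1 | 2 | 3 =>
    simp [cubeCount, Finset.sum_range_succ, cubesPerRun, tribAux]
    try norm_num
  | m + 4 =>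
    have hsum := congrArg (Nat.cast : ℕ → ℚ) (sum_runCount m)
    have h1 := ih (m + 1) (by omega)
    have h2 := ih (m + 2) (by omega)
    have h3 := ih (m + 3) (by omega)
    have hmod : ((m + 4) % 3) = (m + 1) % 3 := by omega
    have hmods : (m + 1) % 3 + (m + 2) % 3 + (m + 3) % 3 = 3 := by omega
    have hmods' := congrArg (Nat.cast : ℕ → ℚ) hmods
    rw [cubeCount_add_four, hmod]
    simp only [tribAux, add_assoc, Nat.reduceAdd] at *
    push_cast at *
    linear_combination h1 + h2 + h3 + hsum / 6 + hmods' / 3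

theorem repeated_cubes_at_tribonacci (m : ℤ) (hm : 3 ≤ m) :
    (D (t m) : ℚ) =
      (m : ℚ) / 22 * (-6 * (t m : ℚ) + 8 * (t (m - 1) : ℚ) + 7 * (t (m - 2) : ℚ)) +
      1 / 44 * (-23 * (t m : ℚ) + 34 * (t (m - 1) : ℚ) - 5 * (t (m - 2) : ℚ)) +
      (m : ℚ) / 6 -
      1 / 4 * (if m % 3 = 0 then 1 else 0) +
      1 / 12 * (if m % 3 = 1 then 1 else 0) +
      5 / 12 * (if m % 3 = 2 then 1 else 0) := by
  obtain ⟨n, rfl⟩ := Int.eq_ofNat_of_zero_le (show 0 ≤ m by omega)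
  have h0 : t (n : ℤ) = tribAux (n + 2) := rfl
  have h1 : t ((n : ℤ) - 1) = tribAux (n + 1) := by
    rw [t]
    congr 1
    omega
  have h2 : t ((n : ℤ) - 2) = tribAux n := by
    rw [t]
    congr 1
    omega
  have hD : D (tribAux (n + 2)) = cubeCount n := D_tribAux n
  rw [h0, h1, h2, hD, cubeCount_eq]
  push_cast
  rcases (show n % 3 = 0 ∨ n % 3 = 1 ∨ n % 3 = 2 by omega) with h | h | h <;>
    (have h' : (n : ℤ) % 3 = (n % 3 : ℕ) := by omega) <;> rw [h', h] <;> norm_num <;> ring
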